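/- Let n >= 2, let q be a prime power, and let i be n-3 or n-2 with i >= -1. Let pi be an n-dimensional projective subspace of PG(2n+1,q^2) such that pi_i := pi intersect pi^sigma has projective dimension i. Let P be a point of H(2n+1,q^2) lying neither on pi nor on pi^sigma, lying on the projective span of pi and pi^sigma, and lying on some projective line all of whose points lie on H(2n+1,q^2) that contains both a point on pi but not on pi_i and a point on pi^sigma but not on pi_i. Then the number of generators mu of H(2n+1,q^2) through P such that exactly one point of mu lies on pi but not on pi_i, and exactly one point of mu lies on pi^sigma but not on pi_i, equals q^{2i+2} * N(n,i). -/

import Mathlib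

open scoped BigOperators

namespace HermCode

/-- The Hermitian sesquilinear form `h(x,y) = ∑ᵢ xᵢ * yᵢ^q` on `F^m`. -/
def herm (q : ℕ) {F : Type} [Field F] {m : ℕ} (x y : Fin m → F) : F :=
  ∑ i, x i * (y i) ^ q

/-- For a fixed vector `x`, the linear map `y ↦ h(y,x)`. -/
def hermL (q : ℕ) {F : Type} [Field F] {m : ℕ} (x : Fin m → F) :
    (Fin m → F) →ₗ[F] F where
  toFun y := herm q y x
  map_add' a b := by
    simp [herm, add_mul, Finset.sum_add_distrib]
  map_smul' c a := by
    simp [herm, Finset.mul_sum, mul_assoc]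

/-- The image `W^σ` of a subspace `W` under the Hermitian polarity `σ`:
the subspace of all vectors orthogonal to every vector of `W`
with respect to the Hermitian form. -/
def polar (q : ℕ) {F : Type} [Field F] {m : ℕ} (W : Submodule F (Fin m → F)) :
    Submodule F (Fin m → F) :=
  ⨅ x : W, LinearMap.ker (hermL q (x : Fin m → F))

/-- A subspace all of whose points lie on the Hermitian variety. -/
def TotallyIsotropic (q : ℕ) {F : Type} [Field F] {m : ℕ}
    (W : Submodule F (Fin m → F)) : Prop :=
  ∀ x ∈ W, herm q x x = 0

/-- A point of the Hermitian variety: a projective point (1-dimensional subspace)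
spanned by an isotropic vector. -/
def IsHermPoint (q : ℕ) {F : Type} [Field F] {m : ℕ}
    (P : Submodule F (Fin m → F)) : Prop :=
  Module.finrank F P = 1 ∧ TotallyIsotropic q P

/-- A generator of `H(2n+1,q²)`: an `n`-dimensional projective subspace all of
whose points lie on the Hermitian variety. -/
def IsGenerator (q n : ℕ) {F : Type} [Field F]
    (W : Submodule F (Fin (2*n+2) → F)) : Prop :=
  Module.finrank F W = n + 1 ∧ TotallyIsotropic q W

/-- A code word of the dual code `C_n(H(2n+1,q²))^⊥`: a function from points to `F_p`
(vanishing off the Hermitian variety) summing to zero over every generator. -/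
def IsCodeword (p q n : ℕ) {F : Type} [Field F]
    (c : Submodule F (Fin (2*n+2) → F) → ZMod p) : Prop :=
  (∀ P, ¬ IsHermPoint q P → c P = 0) ∧
  ∀ μ, IsGenerator q n μ → (∑ᶠ P ∈ {P | IsHermPoint q P ∧ P ≤ μ}, c P) = 0

/-- The (Hamming) weight of a code word. -/
noncomputable def wt {p : ℕ} {α : Type*} (c : α → ZMod p) : ℕ :=
  Nat.card {x : α // c x ≠ 0}

open scoped Classical in
/-- The incidence vector `v_π` of `π ∩ H`. -/
noncomputable def vsub (p q : ℕ) {F : Type} [Field F] {m : ℕ}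
    (π : Submodule F (Fin m → F)) : Submodule F (Fin m → F) → ZMod p :=
  fun P => if IsHermPoint q P ∧ P ≤ π then 1 else 0

/-- `θ_m(q)`, the number of points of `PG(m,q)`. -/
noncomputable def theta (q : ℕ) (m : ℤ) : ℚ :=
  ((q:ℚ)^(m+1) - 1) / ((q:ℚ) - 1)

/-- `μ_m(q²)`, the number of points of `H(m,q²)` (with `μ_{-1} = 0`). -/
noncomputable def muH (q : ℕ) (m : ℤ) : ℚ :=
  (((q:ℚ)^(m+1) - (-1:ℚ)^(m+1)) * ((q:ℚ)^m - (-1:ℚ)^m)) / ((q:ℚ)^2 - 1)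

/-- The number `N(n,i)`. -/
noncomputable def NN (q n : ℕ) (i : ℤ) : ℚ :=
  (q:ℚ)^(((n:ℤ)-1)^2 - ((((n:ℤ)-i-1).toNat.choose 2 : ℕ) : ℤ)) *
    ∏ j ∈ Finset.range ((n:ℤ)-i-2).toNat, ((q:ℚ)^(j+1) - (-1:ℚ)^(j+1))

open scoped Classical in
/-- The quantity `Σ_{n,i}`. -/
noncomputable def SigmaNI (q n : ℕ) (i : ℤ) : ℚ :=
  if Odd ((n:ℤ) - i) then
    2*(q:ℚ)^(2*i+2) * muH q ((n:ℤ)-i-1)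
      + 4 * muH q ((n:ℤ)-i-2) * ((q:ℚ)^((n:ℤ)-i-1) - 1)
          / ((q:ℚ)^((n:ℤ)-3*i-5) * ((q:ℚ)^2 - 1))
  else
    2*(q:ℚ)^(2*i+2) * (muH q ((n:ℤ)-i-1)
      + 2*((q:ℚ)^(4:ℤ) * muH q ((n:ℤ)-i-3) + (q:ℚ)^2 - 1)/((q:ℚ)^2 - 1))

/-- `P` lies on a projective line entirely contained in the Hermitian variety that
meets both `π \ (π ⊓ π^σ)` and `π^σ \ (π ⊓ π^σ)`. -/
def OnGoodLine (q : ℕ) {F : Type} [Field F] {m : ℕ}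
    (π P : Submodule F (Fin m → F)) : Prop :=
  ∃ A B : Submodule F (Fin m → F),
    Module.finrank F A = 1 ∧ A ≤ π ∧ ¬ A ≤ π ⊓ polar q π ∧
    Module.finrank F B = 1 ∧ B ≤ polar q π ∧ ¬ B ≤ π ⊓ polar q π ∧
    P ≤ A ⊔ B ∧ TotallyIsotropic q (A ⊔ B)


structure QD (q : ℕ) (F : Type) [Field F] [Fintype F] : Prop where
  two : 2 ≤ q
  add : ∀ x y : F, (x + y) ^ q = x ^ q + y ^ q
  card : Fintype.card F = q ^ 2

set_option linter.unusedSectionVars false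

section field
variable {q : ℕ} {F : Type} [Field F] [Fintype F]

lemma QD.inv (hd : QD q F) (x : F) : (x ^ q) ^ q = x := by
  rw [← pow_mul, ← sq, ← hd.card, FiniteField.pow_card]

lemma QD.zero (hd : QD q F) : (0 : F) ^ q = 0 := zero_pow (by have := hd.two; omega)

lemma QD.neg (hd : QD q F) (x : F) : (-x) ^ q = - x ^ q := by
  have := hd.add x (-x)
  rw [add_neg_cancel, hd.zero] at this
  exact (neg_eq_of_add_eq_zero_right this.symm).symm

lemma QD.sum (hd : QD q F) {ι : Type*} (s : Finset ι) (f : ι → F) :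
    (∑ i ∈ s, f i) ^ q = ∑ i ∈ s, f i ^ q := by
  classical
  induction s using Finset.induction_on with
  | empty => simp [hd.zero]
  | insert a s ha ih => rw [Finset.sum_insert ha, Finset.sum_insert ha, hd.add, ih]

lemma QD.exists_ne (hd : QD q F) (c : F) : ∃ x : F, x ^ q + c * x ≠ 0 := by
  classical
  by_contra! h
  have h2 := hd.two
  let P : Polynomial F := Polynomial.X ^ q + Polynomial.C c * Polynomial.X
  have hdeg : P.natDegree = q := by
    have : (Polynomial.C c * Polynomial.X : Polynomial F).natDegree < (Polynomial.X ^ q : Polynomial F).natDegree := by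
      rw [Polynomial.natDegree_X_pow]
      exact lt_of_le_of_lt ((Polynomial.natDegree_C_mul_le c _).trans Polynomial.natDegree_X_le) (by omega)
    rw [Polynomial.natDegree_add_eq_left_of_natDegree_lt this, Polynomial.natDegree_X_pow]
  have hP : P = 0 := by
    apply Polynomial.eq_zero_of_natDegree_lt_card_of_eval_eq_zero P (f := fun x : F => x) Function.injective_id
    · intro x; simpa [P] using h x
    · rw [hdeg, hd.card]; nlinarith
  rw [hP] at hdeg
  simp at hdeg
  omega

lemma QD.exists_delta (hd : QD q F) : ∃ δ : F, δ + δ ^ q = 1 := by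
  obtain ⟨y, hy⟩ := hd.exists_ne 1
  rw [one_mul] at hy
  refine ⟨y / (y ^ q + y), ?_⟩
  rw [div_pow, hd.add, hd.inv]
  rw [add_comm y (y ^ q), ← add_div, add_comm y (y ^ q), div_self hy]

lemma QD.exists_eps (hd : QD q F) : ∃ ε : F, ε ≠ 0 ∧ ε ^ q = - ε := by
  obtain ⟨y, hy⟩ := hd.exists_ne (-1)
  refine ⟨y ^ q + -1 * y, hy, ?_⟩
  rw [hd.add, hd.inv, neg_one_mul, hd.neg]; ring

lemma QD.exists_norm (hd : QD q F) (c : F) (hc : c ^ q = c) : ∃ s : F, s * s ^ q = c := by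
  classical
  by_cases h0 : c = 0
  · exact ⟨0, by simp [h0]⟩
  obtain ⟨g, hg⟩ := IsCyclic.exists_generator (α := Fˣ)
  obtain ⟨k, hk⟩ := (Submonoid.mem_powers_iff _ _).1 ((mem_powers_iff_mem_zpowers).2 (hg (Units.mk0 c h0)))
  have h2 := hd.two
  have ho : orderOf g = q ^ 2 - 1 := by
    rw [orderOf_eq_card_of_forall_mem_zpowers hg, Nat.card_eq_fintype_card, Fintype.card_units, hd.card]
  have h1 : (Units.mk0 c h0) ^ (q - 1) = 1 := by
    ext
    simp only [Units.val_pow_eq_pow_val, Units.val_mk0, Units.val_one]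
    have : c ^ (q - 1) * c = c := by rw [← pow_succ, Nat.sub_add_cancel (by omega), hc]
    exact mul_right_cancel₀ h0 (by rw [this, one_mul])
  rw [← hk, ← pow_mul] at h1
  have h3 := orderOf_dvd_of_pow_eq_one h1
  rw [ho] at h3
  have h4 : q ^ 2 - 1 = (q + 1) * (q - 1) := by
    have := Nat.sq_sub_sq q 1
    simpa using this
  rw [h4] at h3
  obtain ⟨m, hm⟩ := Nat.dvd_of_mul_dvd_mul_right (by omega) h3
  refine ⟨((g ^ m : Fˣ) : F), ?_⟩
  have : ((g ^ k : Fˣ) : F) = c := by rw [hk]; rfl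
  rw [← this, hm]
  push_cast
  ring

lemma QD.matcard (hd : QD q F) (d : ℕ) (H : Fin d → Fin d → F) (hH : ∀ i j, H i j ^ q = H j i) :
    Nat.card {C : Fin d → Fin d → F // ∀ i j, C i j + C j i ^ q = - H i j} = q ^ (d ^ 2) := by
  classical
  obtain ⟨δ, hδ⟩ := hd.exists_delta
  obtain ⟨ε, hε0, hε⟩ := hd.exists_eps
  have hδ' : δ ^ q = 1 - δ := by rw [← hδ]; ring
  let K := {C : Fin d → Fin d → F // ∀ i j, C i j + C j i ^ q = 0}
  let L := {C : Fin d → Fin d → F // ∀ i j, C i j ^ q = C j i}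
  have e1 : {C : Fin d → Fin d → F // ∀ i j, C i j + C j i ^ q = - H i j} ≃ K :=
    { toFun := fun C => ⟨fun i j => C.1 i j + δ * H i j, fun i j => by
        have := C.2 i j
        rw [hd.add, mul_pow, hH, hδ']
        linear_combination this⟩
      invFun := fun C => ⟨fun i j => C.1 i j - δ * H i j, fun i j => by
        have := C.2 i j
        beta_reduce
        rw [sub_eq_add_neg (C.1 j i), hd.add, hd.neg, mul_pow, hH, hδ']
        linear_combination this⟩
      left_inv := fun C => by ext; simp
      right_inv := fun C => by ext; simp }
  have e2 : K ≃ L :=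
    { toFun := fun C => ⟨fun i j => ε * C.1 i j, fun i j => by
        have := C.2 j i
        rw [mul_pow, hε]
        linear_combination (-ε) * this⟩
      invFun := fun C => ⟨fun i j => ε⁻¹ * C.1 i j, fun i j => by
        have := C.2 j i
        rw [mul_pow, inv_pow, hε, this, inv_neg]
        ring⟩
      left_inv := fun C => by ext; simp [hε0]
      right_inv := fun C => by ext; simp [hε0] }
  have e3 : (Fin d → Fin d → F) ≃ L × K :=
    { toFun := fun C => (⟨fun i j => C i j + C j i ^ q, fun i j => by rw [hd.add, hd.inv]; ring⟩,
        ⟨fun i j => C i j - δ * (C i j + C j i ^ q), fun i j => by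
          beta_reduce
          rw [sub_eq_add_neg (C j i), hd.add, hd.neg, mul_pow, hd.add, hd.inv, hδ']
          ring⟩)
      invFun := fun x => fun i j => x.2.1 i j + δ * x.1.1 i j
      left_inv := fun C => by ext; simp
      right_inv := fun x => by
        obtain ⟨⟨A, hA⟩, ⟨B, hB⟩⟩ := x
        have : ∀ i j, B i j + δ * A i j + (B j i + δ * A j i) ^ q = A i j := by
          intro i j
          rw [hd.add, mul_pow, hA, hδ']
          linear_combination hB i j
        simp [this] }
  have h3 := Nat.card_congr e3
  rw [Nat.card_prod, ← Nat.card_congr e2] at h3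
  have hM : Nat.card (Fin d → Fin d → F) = (q ^ (d ^ 2)) ^ 2 := by
    simp [Nat.card_eq_fintype_card, hd.card]
    ring
  rw [hM] at h3
  rw [Nat.card_congr e1]
  have : Nat.card K ^ 2 = (q ^ d ^ 2) ^ 2 := by rw [h3]; ring
  exact Nat.pow_left_injective (n := 2) (by norm_num) this

end field

lemma card_rel {X T : Type*} [Finite X] [Finite T] (r : X → T → Prop) (c : ℕ)
    (h1 : ∀ x, ∃! t, r x t) (h2 : ∀ t, Nat.card {x // r x t} = c) :
    Nat.card X = Nat.card T * c := by
  classical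
  choose g hg hu using h1
  have e : X ≃ Σ t, {x // r x t} :=
    { toFun := fun x => ⟨g x, x, hg x⟩
      invFun := fun y => y.2.1
      left_inv := fun x => rfl
      right_inv := fun ⟨t, x, hx⟩ => by
        have := hu x t hx
        subst this
        rfl }
  have := Fintype.ofFinite T
  rw [Nat.card_congr e, Nat.card_sigma]
  simp [h2, Nat.card_eq_fintype_card]

section form
variable {q : ℕ} {F : Type} [Field F] [Fintype F] {m : ℕ}

lemma herm_add_left (x y z : Fin m → F) : herm q (x + y) z = herm q x z + herm q y z :=
  (hermL q z).map_add x y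

lemma herm_smul_left (c : F) (x z : Fin m → F) : herm q (c • x) z = c * herm q x z :=
  (hermL q z).map_smul c x

lemma herm_zero_left (z : Fin m → F) : herm q 0 z = 0 := (hermL q z).map_zero

lemma herm_neg_left (x z : Fin m → F) : herm q (-x) z = -herm q x z := (hermL q z).map_neg x

lemma herm_sub_left (x y z : Fin m → F) : herm q (x - y) z = herm q x z - herm q y z :=
  (hermL q z).map_sub x y

lemma herm_sum_left {ι : Type*} (s : Finset ι) (f : ι → Fin m → F) (z : Fin m → F) :
    herm q (∑ i ∈ s, f i) z = ∑ i ∈ s, herm q (f i) z :=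
  map_sum (hermL q z) f s

lemma herm_symm (hd : QD q F) (x y : Fin m → F) : herm q x y ^ q = herm q y x := by
  simp only [herm, hd.sum, mul_pow, hd.inv]
  exact Finset.sum_congr rfl fun _ _ => mul_comm _ _

lemma herm_add_right (hd : QD q F) (x y z : Fin m → F) :
    herm q x (y + z) = herm q x y + herm q x z := by
  rw [← herm_symm hd, herm_add_left, hd.add, herm_symm hd, herm_symm hd]

lemma herm_smul_right (hd : QD q F) (c : F) (x y : Fin m → F) :
    herm q x (c • y) = c ^ q * herm q x y := by
  rw [← herm_symm hd, herm_smul_left, mul_pow, herm_symm hd]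

lemma herm_zero_right (hd : QD q F) (x : Fin m → F) : herm q x 0 = 0 := by
  rw [← herm_symm hd, herm_zero_left, hd.zero]

lemma herm_sum_right (hd : QD q F) {ι : Type*} (s : Finset ι) (f : ι → Fin m → F) (z : Fin m → F) :
    herm q z (∑ i ∈ s, f i) = ∑ i ∈ s, herm q z (f i) := by
  rw [← herm_symm hd, herm_sum_left, hd.sum]
  exact Finset.sum_congr rfl fun _ _ => herm_symm hd _ _

lemma herm_comm_zero (hd : QD q F) {x y : Fin m → F} (h : herm q x y = 0) : herm q y x = 0 := by
  rw [← herm_symm hd, h, hd.zero]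

lemma herm_nondeg (hd : QD q F) (x : Fin m → F) (h : ∀ y, herm q y x = 0) : x = 0 := by
  classical
  funext j
  have := h (Pi.single j 1)
  simp only [herm, Pi.single_apply, ite_mul, one_mul, zero_mul, Finset.sum_ite_eq',
    Finset.mem_univ, if_true] at this
  simpa using pow_eq_zero_iff (by have := hd.two; omega) |>.1 this

lemma mem_polar {W : Submodule F (Fin m → F)} {y : Fin m → F} :
    y ∈ polar q W ↔ ∀ x ∈ W, herm q y x = 0 := by
  simp only [polar, Submodule.mem_iInf, LinearMap.mem_ker, Subtype.forall]
  exact Iff.rfl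

lemma le_polar_symm (hd : QD q F) {A B : Submodule F (Fin m → F)} (h : A ≤ polar q B) :
    B ≤ polar q A := fun _ hy => mem_polar.2 fun x hx =>
  herm_comm_zero hd (mem_polar.1 (h hx) _ hy)

lemma polar_anti {A B : Submodule F (Fin m → F)} (h : A ≤ B) : polar q B ≤ polar q A :=
  fun _ hy => mem_polar.2 fun x hx => mem_polar.1 hy x (h hx)

lemma span_le_polar (hd : QD q F) {s t : Set (Fin m → F)} (h : ∀ x ∈ s, ∀ y ∈ t, herm q x y = 0) :
    Submodule.span F s ≤ polar q (Submodule.span F t) := by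
  have h1 : ∀ y ∈ t, y ∈ polar q (Submodule.span F s) := by
    intro y hy
    apply le_polar_symm hd (B := Submodule.span F {y}) _ (Submodule.mem_span_singleton_self y)
    rw [Submodule.span_le]
    intro x hx
    refine mem_polar.2 fun z hz => ?_
    obtain ⟨c, rfl⟩ := Submodule.mem_span_singleton.1 hz
    rw [herm_smul_right hd, h x hx y hy, mul_zero]
  exact le_polar_symm hd (Submodule.span_le.2 h1)

lemma sup_le_polar (hd : QD q F) {A B C : Submodule F (Fin m → F)} (h1 : A ≤ polar q B)
    (h2 : A ≤ polar q C) : A ≤ polar q (B ⊔ C) :=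
  le_polar_symm hd (sup_le (le_polar_symm hd h1) (le_polar_symm hd h2))

lemma ti_of_le {W : Submodule F (Fin m → F)} (h : W ≤ polar q W) : TotallyIsotropic q W :=
  fun x hx => mem_polar.1 (h hx) x hx

lemma TotallyIsotropic.le (hd : QD q F) {W : Submodule F (Fin m → F)} (h : TotallyIsotropic q W) :
    W ≤ polar q W := by
  intro x hx
  refine mem_polar.2 fun y hy => ?_
  by_contra hne
  obtain ⟨δ, hδ⟩ := hd.exists_delta
  have key : ∀ c : F, c * herm q x y + (c * herm q x y) ^ q = 0 := by
    intro c
    have h1 := h (c • x + y) (W.add_mem (W.smul_mem c hx) hy)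
    rw [herm_add_left, herm_add_right hd, herm_add_right hd, herm_smul_left, herm_smul_right hd,
      h x hx, h y hy, herm_smul_left, herm_smul_right hd, ← herm_symm hd x y] at h1
    rw [mul_pow]
    linear_combination h1
  have := key (δ / herm q x y)
  rw [div_mul_cancel₀ _ hne, hδ] at this
  exact one_ne_zero this

lemma TotallyIsotropic.eq (hd : QD q F) {W : Submodule F (Fin m → F)} (h : TotallyIsotropic q W)
    {x y : Fin m → F} (hx : x ∈ W) (hy : y ∈ W) : herm q x y = 0 :=
  mem_polar.1 (h.le hd hx) y hy

lemma TotallyIsotropic.mono {W U : Submodule F (Fin m → F)} (h : TotallyIsotropic q W)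
    (hU : U ≤ W) : TotallyIsotropic q U := fun x hx => h x (hU hx)

lemma ti_sup (hd : QD q F) {A B : Submodule F (Fin m → F)} (hA : TotallyIsotropic q A)
    (hB : TotallyIsotropic q B) (hAB : A ≤ polar q B) : TotallyIsotropic q (A ⊔ B) :=
  ti_of_le (sup_le (sup_le_polar hd (hA.le hd) hAB)
    (sup_le_polar hd (le_polar_symm hd hAB) (hB.le hd)))

lemma herm_surj (hd : QD q F) {ι : Type*} [Fintype ι] (w : ι → Fin m → F)
    (hw : LinearIndependent F w) :
    Function.Surjective (LinearMap.pi fun j => hermL q (w j)) := by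
  classical
  rw [← LinearMap.range_eq_top]
  by_contra hne
  obtain ⟨φ, hφ0, hφ⟩ := Submodule.exists_le_ker_of_lt_top _ (lt_top_iff_ne_top.2 hne)
  have hφs : ∀ v, φ v = ∑ j, v j * φ (Pi.single j 1) := by
    intro v
    conv_lhs => rw [pi_eq_sum_univ' v]
    simp [map_sum, Pi.single_apply, map_smul]
  have h1 : ∑ j, (φ (Pi.single j 1)) ^ q • w j = 0 := by
    apply herm_nondeg hd
    intro y
    rw [herm_sum_right hd]
    have : φ (LinearMap.pi (fun j => hermL q (w j)) y) = 0 := hφ ⟨y, rfl⟩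
    rw [hφs] at this
    rw [← this]
    refine Finset.sum_congr rfl fun j _ => ?_
    rw [herm_smul_right hd, hd.inv, mul_comm]
    rfl
  have h2 := Fintype.linearIndependent_iff.1 hw _ h1
  apply hφ0
  ext j
  have := h2 j
  simpa using pow_eq_zero_iff (by have := hd.two; omega) |>.1 this

lemma finrank_polar (hd : QD q F) (W : Submodule F (Fin m → F)) :
    Module.finrank F (polar q W) + Module.finrank F W = m := by
  classical
  let b := Module.finBasis F W
  have hw : LinearIndependent F (fun j => (b j : Fin m → F)) :=
    b.linearIndependent.map' W.subtype (Submodule.ker_subtype W)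
  have hs := herm_surj hd _ hw
  have hk : LinearMap.ker (LinearMap.pi fun j => hermL q (b j : Fin m → F)) = polar q W := by
    ext y
    rw [LinearMap.mem_ker, mem_polar]
    constructor
    · intro h x hx
      have h1 : ∀ j, herm q y (b j) = 0 := fun j => congrFun h j
      have h2 := b.sum_repr ⟨x, hx⟩
      have h3 : x = ∑ j, (b.repr ⟨x, hx⟩ j) • (b j : Fin m → F) := by
        have h4 := congrArg W.subtype h2
        rw [map_sum] at h4
        exact h4.symm
      rw [h3, herm_sum_right hd]
      exact Finset.sum_eq_zero fun j _ => by rw [herm_smul_right hd, h1, mul_zero]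
    · intro h
      ext j
      exact h _ (b j).2
  have := LinearMap.finrank_range_add_finrank_ker (LinearMap.pi fun j => hermL q (b j : Fin m → F))
  rw [hk, LinearMap.range_eq_top.2 hs, finrank_top] at this
  simp at this
  omega

lemma ti_finrank_le (hd : QD q F) {W : Submodule F (Fin m → F)} (h : TotallyIsotropic q W) :
    2 * Module.finrank F W ≤ m := by
  have h1 := finrank_polar hd W
  have h2 := Submodule.finrank_mono (h.le hd)
  omega

end form

section count
variable {q : ℕ} {F : Type} [Field F] [Fintype F] {n : ℕ}

lemma exists_basis_fam {m : ℕ} (W : Submodule F (Fin m → F)) (d : ℕ) (h : Module.finrank F W = d) :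
    ∃ e : Fin d → Fin m → F, LinearIndependent F e ∧ Submodule.span F (Set.range e) = W := by
  let b := Module.finBasisOfFinrankEq F W h
  refine ⟨fun j => (b j : Fin m → F), b.linearIndependent.map' W.subtype (Submodule.ker_subtype W), ?_⟩
  have : Set.range (fun j => (b j : Fin m → F)) = W.subtype '' Set.range b := by
    rw [← Set.range_comp]; rfl
  rw [this, Submodule.span_image, b.span_eq, Submodule.map_subtype_top]

set_option maxHeartbeats 1600000 in
lemma main_count (hd : QD q F) (E S : Submodule F (Fin (2*n+2) → F)) (hE : IsGenerator q n E)
    (hS : S ≤ E) (d : ℕ) (hk : Module.finrank F S + d = n + 1) :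
    Nat.card {μ : Submodule F (Fin (2*n+2) → F) // IsGenerator q n μ ∧ μ ⊓ E = S} = q ^ (d ^ 2) := by
  classical
  obtain ⟨C', hC'⟩ := exists_isCompl S
  obtain ⟨C, hCdef⟩ : ∃ C, C = C' ⊓ E := ⟨_, rfl⟩
  have hSC : S ⊔ C = E := by
    rw [hCdef, ← sup_inf_assoc_of_le C' hS, hC'.sup_eq_top, top_inf_eq]
  have hSC0 : S ⊓ C = ⊥ := by
    rw [eq_bot_iff, ← hC'.inf_eq_bot, hCdef]
    exact inf_le_inf_left _ inf_le_left
  have hCE : C ≤ E := hCdef ▸ inf_le_right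
  have hC : Module.finrank F C = d := by
    have := Submodule.finrank_sup_add_finrank_inf_eq S C
    rw [hSC, hSC0, finrank_bot, hE.1] at this
    omega
  obtain ⟨e, hli_e, hspan_e⟩ := exists_basis_fam C d hC
  obtain ⟨s, hli_s, hspan_s⟩ := exists_basis_fam S _ rfl
  have heC : ∀ j, e j ∈ C := fun j => hspan_e ▸ Submodule.subset_span ⟨j, rfl⟩
  have hli : LinearIndependent F (Sum.elim s e) := by
    apply hli_s.sum_type hli_e
    rw [hspan_s, hspan_e, disjoint_iff, hSC0]
  have hsurj := herm_surj hd _ hli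
  have hf : ∀ j : Fin d, ∃ f : Fin (2*n+2) → F, (∀ i, herm q f (s i) = 0) ∧
      ∀ l, herm q f (e l) = if j = l then 1 else 0 := by
    intro j
    obtain ⟨f, hf⟩ := hsurj (Sum.elim (fun _ => 0) (fun l => if j = l then 1 else 0))
    exact ⟨f, fun i => congrFun hf (Sum.inl i), fun l => congrFun hf (Sum.inr l)⟩
  choose f hfs hfe using hf
  have hfS : ∀ j, f j ∈ polar q S := by
    intro j
    have : Submodule.span F {f j} ≤ polar q (Submodule.span F (Set.range s)) := by
      apply span_le_polar hd
      rintro x rfl y ⟨i, rfl⟩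
      exact hfs j i
    rw [hspan_s] at this
    exact this (Submodule.mem_span_singleton_self _)
  have hef : ∀ l j, herm q (e l) (f j) = if j = l then 1 else 0 := by
    intro l j
    rw [← herm_symm hd, hfe]
    split_ifs <;> simp [hd.zero]
  have hee : ∀ l j, herm q (e l) (e j) = 0 := fun l j => hE.2.eq hd (hCE (heC l)) (hCE (heC j))
  have hSti : TotallyIsotropic q S := hE.2.mono hS
  obtain ⟨H, hHdef⟩ : ∃ H : Fin d → Fin d → F, ∀ j l, H j l = herm q (f j) (f l) :=
    ⟨fun j l => herm q (f j) (f l), fun _ _ => rfl⟩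
  have hH : ∀ j l, H j l ^ q = H l j := fun j l => by rw [hHdef, hHdef, herm_symm hd]
  obtain ⟨g, hg⟩ : ∃ g : (Fin d → Fin d → F) → Fin d → Fin (2*n+2) → F,
      ∀ M j, g M j = f j + ∑ l, M j l • e l := ⟨fun M j => f j + ∑ l, M j l • e l, fun _ _ => rfl⟩
  have hsumC : ∀ c : Fin d → F, ∑ l, c l • e l ∈ C := fun c =>
    Submodule.sum_mem _ fun l _ => C.smul_mem _ (heC l)
  have hgg : ∀ M j l, herm q (g M j) (g M l) = H j l + (M j l + M l j ^ q) := by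
    intro M j l
    simp only [hg, herm_add_left, herm_add_right hd, herm_sum_left, herm_sum_right hd,
      herm_smul_left, herm_smul_right hd, hfe, hef, hee]
    simp [hHdef]
    ring
  have hge : ∀ M j l, herm q (g M j) (e l) = if j = l then 1 else 0 := by
    intro M j l
    simp only [hg, herm_add_left, herm_sum_left, herm_smul_left, hfe, hee]
    simp
  have hgS : ∀ M j, g M j ∈ polar q S := by
    intro M j
    rw [hg]
    exact Submodule.add_mem _ (hfS j) (polar_anti hS (hE.2.le hd (hCE (hsumC _))))
  have hcomb : ∀ M (c : Fin d → F), (∑ j, c j • g M j) ∈ E → c = 0 := by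
    intro M c hc
    funext l
    have h1 : herm q (∑ j, c j • g M j) (e l) = 0 := hE.2.eq hd hc (hCE (heC l))
    rw [herm_sum_left] at h1
    simpa [herm_smul_left, hge] using h1
  obtain ⟨U, hU⟩ : ∃ U : (Fin d → Fin d → F) → Submodule F (Fin (2*n+2) → F), ∀ M, U M =
    S ⊔ Submodule.span F (Set.range (g M)) := ⟨fun M => S ⊔ Submodule.span F (Set.range (g M)), fun _ => rfl⟩
  have hUE : ∀ M, U M ⊓ E = S := by
    intro M
    rw [hU]
    apply le_antisymm
    · rintro x ⟨hx, hxE⟩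
      obtain ⟨y, hy, z, hz, rfl⟩ := Submodule.mem_sup.1 hx
      obtain ⟨c, rfl⟩ := (Submodule.mem_span_range_iff_exists_fun F).1 hz
      have : c = 0 := hcomb M c (by
        have := E.sub_mem hxE (hS hy)
        simpa using this)
      subst this
      simpa using hy
    · exact le_inf le_sup_left hS
  have hUdim : ∀ M, Module.finrank F (U M) = n + 1 := by
    intro M
    have h1 : LinearIndependent F (g M) := by
      rw [Fintype.linearIndependent_iff]
      intro c hc
      have := hcomb M c (by rw [hc]; exact E.zero_mem)
      intro i; rw [this]; rfl
    have h2 := finrank_span_eq_card h1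
    have h3 : S ⊓ Submodule.span F (Set.range (g M)) = ⊥ := by
      rw [eq_bot_iff]
      rintro x ⟨hx, hxg⟩
      obtain ⟨c, rfl⟩ := (Submodule.mem_span_range_iff_exists_fun F).1 hxg
      have : c = 0 := hcomb M c (hS hx)
      subst this
      simp
    have h4 := Submodule.finrank_sup_add_finrank_inf_eq S (Submodule.span F (Set.range (g M)))
    rw [h3, finrank_bot, h2, Fintype.card_fin] at h4
    rw [hU]
    omega
  have hUti : ∀ M, (∀ i j, M i j + M j i ^ q = - H i j) → TotallyIsotropic q (U M) := by
    intro M hM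
    rw [hU]
    apply ti_sup hd hSti
    · apply ti_of_le
      apply span_le_polar hd
      rintro x ⟨j, rfl⟩ y ⟨l, rfl⟩
      rw [hgg, hM, add_neg_cancel]
    · apply le_polar_symm hd
      rw [Submodule.span_le]
      rintro x ⟨j, rfl⟩
      exact hgS M j
  have hgU : ∀ M j, g M j ∈ U M := fun M j => by
    rw [hU]
    exact Submodule.mem_sup_right (Submodule.subset_span ⟨j, rfl⟩)
  rw [← hd.matcard d H hH]
  symm
  apply Nat.card_eq_of_bijective
    (fun M => (⟨U M.1, ⟨hUdim M.1, hUti M.1 M.2⟩, hUE M.1⟩ : {μ : Submodule F (Fin (2*n+2) → F) // IsGenerator q n μ ∧ μ ⊓ E = S}))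
  constructor
  · rintro ⟨M, hM⟩ ⟨M', hM'⟩ heq
    have heq' : U M = U M' := congrArg Subtype.val heq
    apply Subtype.ext
    funext j
    have h1 : g M j - g M' j ∈ U M := Submodule.sub_mem _ (hgU M j) (heq' ▸ hgU M' j)
    have h2 : g M j - g M' j = ∑ l, (M j l - M' j l) • e l := by
      simp [hg, sub_smul, Finset.sum_sub_distrib]
    rw [h2] at h1
    have h3 := hsumC (fun l => M j l - M' j l)
    have h4 : ∑ l, (M j l - M' j l) • e l ∈ S ⊓ C := ⟨by rw [← hUE M]; exact ⟨h1, hCE h3⟩, h3⟩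
    rw [hSC0, Submodule.mem_bot] at h4
    have h5 := Fintype.linearIndependent_iff.1 hli_e _ h4
    funext l
    exact sub_eq_zero.1 (h5 l)
  · rintro ⟨μ, hμ, hμE⟩
    have hSμ : S ≤ μ := by rw [← hμE]; exact inf_le_left
    have hsum : μ ⊔ E = polar q S := by
      apply Submodule.eq_of_le_of_finrank_eq
      · exact sup_le ((hμ.2.le hd).trans (polar_anti hSμ)) ((hE.2.le hd).trans (polar_anti hS))
      · have h1 := Submodule.finrank_sup_add_finrank_inf_eq μ E
        have h2 := finrank_polar hd S
        rw [hμE, hμ.1, hE.1] at h1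
        omega
    have hM : ∀ j, ∃ c : Fin d → F, f j + ∑ l, c l • e l ∈ μ := by
      intro j
      have := hfS j
      rw [← hsum, ← hSC] at this
      obtain ⟨x, hx, y, hy, hxy⟩ := Submodule.mem_sup.1 this
      obtain ⟨y1, hy1, z, hz, rfl⟩ := Submodule.mem_sup.1 hy
      rw [← hspan_e] at hz
      obtain ⟨c, rfl⟩ := (Submodule.mem_span_range_iff_exists_fun F).1 hz
      refine ⟨-c, ?_⟩
      rw [← hxy]
      have := μ.add_mem hx (hSμ hy1)
      convert this using 1
      simp
      abel
    choose M hM using hM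
    refine ⟨⟨M, fun i j => ?_⟩, ?_⟩
    · have := hμ.2.eq hd (hM i) (hM j)
      have h2 := hgg M i j
      rw [hg, hg, this] at h2
      linear_combination -h2
    · apply Subtype.ext
      apply Submodule.eq_of_le_of_finrank_eq
      · change U M ≤ μ
        rw [hU]
        refine sup_le hSμ ?_
        rw [Submodule.span_le]
        rintro x ⟨j, rfl⟩
        rw [hg]
        exact hM j
      · exact (hUdim M).trans hμ.1.symm

end count

section count2
variable {q : ℕ} {F : Type} [Field F] [Fintype F] {n : ℕ}

lemma finrank_sup_singleton {m : ℕ} {W : Submodule F (Fin m → F)} {g : Fin m → F} (hg : g ∉ W) :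
    Module.finrank F (W ⊔ Submodule.span F {g} : Submodule F (Fin m → F)) = Module.finrank F W + 1 := by
  have hg0 : g ≠ 0 := fun h => hg (h ▸ W.zero_mem)
  have h1 := Submodule.finrank_sup_add_finrank_inf_eq W (Submodule.span F {g})
  have h2 : W ⊓ Submodule.span F {g} = ⊥ := by
    rw [← disjoint_iff, Submodule.disjoint_span_singleton' hg0]
    exact hg
  rw [h2, finrank_bot, finrank_span_singleton hg0] at h1
  omega

lemma ti_singleton (hd : QD q F) {m : ℕ} {g : Fin m → F} (hg : herm q g g = 0) :
    TotallyIsotropic q (Submodule.span F {g}) := by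
  apply ti_of_le
  apply span_le_polar hd
  rintro x rfl y rfl
  exact hg

lemma singleton_le_polar (hd : QD q F) {m : ℕ} {W : Submodule F (Fin m → F)} {g : Fin m → F}
    (hg : g ∈ polar q W) : W ≤ polar q (Submodule.span F {g}) := by
  apply le_polar_symm hd
  rw [Submodule.span_singleton_le_iff_mem]
  exact hg

lemma exists_mem_not_mem {m : ℕ} {A B : Submodule F (Fin m → F)}
    (h : Module.finrank F B < Module.finrank F A) : ∃ x ∈ A, x ∉ B := by
  by_contra! hc
  have := Submodule.finrank_mono (show A ≤ B from hc)
  omega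

lemma exists_gen (hd : QD q F) (E0 : Submodule F (Fin (2*n+2) → F)) (hti : TotallyIsotropic q E0)
    (hdim : Module.finrank F E0 = n) : ∃ E, IsGenerator q n E ∧ E0 ≤ E := by
  have hp := finrank_polar hd E0
  have key : ∃ g ∈ polar q E0, g ∉ E0 ∧ herm q g g = 0 := by
    obtain ⟨u, hu, huE⟩ := exists_mem_not_mem (A := polar q E0) (B := E0) (by omega)
    by_cases h0 : herm q u u = 0
    · exact ⟨u, hu, huE, h0⟩
    obtain ⟨v, hv, hvE⟩ := exists_mem_not_mem (A := polar q E0) (B := E0 ⊔ Submodule.span F {u})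
      (by rw [finrank_sup_singleton huE]; omega)
    obtain ⟨w, hw⟩ : ∃ w, w = v - (herm q v u / herm q u u) • u := ⟨_, rfl⟩
    have hwu : herm q w u = 0 := by
      rw [hw, herm_sub_left, herm_smul_left, div_mul_cancel₀ _ h0, sub_self]
    have huw : herm q u w = 0 := herm_comm_zero hd hwu
    obtain ⟨s, hs⟩ := hd.exists_norm (-(herm q w w) / herm q u u) (by
      rw [div_pow, hd.neg, herm_symm hd, herm_symm hd])
    have hwp : w ∈ polar q E0 := by
      rw [hw]; exact Submodule.sub_mem _ hv (Submodule.smul_mem _ _ hu)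
    refine ⟨s • u + w, Submodule.add_mem _ (Submodule.smul_mem _ _ hu) hwp, ?_, ?_⟩
    · intro hmem
      apply hvE
      have : v = (s • u + w) + (herm q v u / herm q u u - s) • u := by
        rw [hw, sub_smul]; abel
      rw [this]
      exact Submodule.add_mem_sup hmem (Submodule.smul_mem _ _ (Submodule.mem_span_singleton_self u))
    · rw [herm_add_left, herm_add_right hd, herm_add_right hd, herm_smul_left, herm_smul_left,
        herm_smul_right hd, herm_smul_right hd, hwu, huw]
      have : s * s ^ q * herm q u u = - herm q w w := by
        rw [hs, div_mul_cancel₀ _ h0]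
      linear_combination this
  obtain ⟨g, hg, hgE, hgg⟩ := key
  refine ⟨E0 ⊔ Submodule.span F {g}, ⟨?_, ?_⟩, le_sup_left⟩
  · rw [finrank_sup_singleton hgE, hdim]
  · exact ti_sup hd hti (ti_singleton hd hgg) (singleton_le_polar hd hg)

lemma gen_count (hd : QD q F) (E0 : Submodule F (Fin (2*n+2) → F)) (hti : TotallyIsotropic q E0)
    (hdim : Module.finrank F E0 = n) :
    Nat.card {E : Submodule F (Fin (2*n+2) → F) // IsGenerator q n E ∧ E0 ≤ E} = q + 1 := by
  classical
  obtain ⟨E1, hE1, h01⟩ := exists_gen hd E0 hti hdim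
  have h1 := main_count hd E1 E0 hE1 h01 1 (by omega)
  have hset : {E : Submodule F (Fin (2*n+2) → F) | IsGenerator q n E ∧ E0 ≤ E} =
      insert E1 {μ | IsGenerator q n μ ∧ μ ⊓ E1 = E0} := by
    ext E
    simp only [Set.mem_ofPred_eq, Set.mem_insert_iff]
    constructor
    · rintro ⟨hE, h0⟩
      by_cases h : E = E1
      · exact Or.inl h
      right
      refine ⟨hE, ?_⟩
      symm
      apply Submodule.eq_of_le_of_finrank_le (le_inf h0 h01)
      by_contra hlt
      apply h
      have h2 : E ⊓ E1 = E := by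
        apply Submodule.eq_of_le_of_finrank_le inf_le_left
        rw [hE.1]; omega
      apply Submodule.eq_of_le_of_finrank_eq (inf_eq_left.1 h2)
      rw [hE.1, hE1.1]
    · rintro (rfl | ⟨h, rfl⟩)
      · exact ⟨hE1, h01⟩
      · exact ⟨h, inf_le_left⟩
  have hnot : E1 ∉ {μ : Submodule F (Fin (2*n+2) → F) | IsGenerator q n μ ∧ μ ⊓ E1 = E0} := by
    rintro ⟨_, h⟩
    rw [inf_idem] at h
    have := hE1.1
    rw [h] at this
    omega
  change Set.ncard {E : Submodule F (Fin (2*n+2) → F) | IsGenerator q n E ∧ E0 ≤ E} = q + 1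
  change Set.ncard {μ : Submodule F (Fin (2*n+2) → F) | IsGenerator q n μ ∧ μ ⊓ E1 = E0} = _ at h1
  rw [hset, Set.ncard_insert_of_notMem hnot (Set.toFinite _), h1]
  simp

lemma count_case1 (hd : QD q F) (ℓ R : Submodule F (Fin (2*n+2) → F)) (hl : Module.finrank F ℓ = 2)
    (hR : Module.finrank F R + 1 = n) (hlR : ℓ ⊓ R = ⊥) (hti : TotallyIsotropic q (ℓ ⊔ R)) :
    Nat.card {μ : Submodule F (Fin (2*n+2) → F) // IsGenerator q n μ ∧ ℓ ≤ μ ∧ μ ⊓ R = ⊥}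
      = q ^ ((n - 1) ^ 2) := by
  have hdim := Submodule.finrank_sup_add_finrank_inf_eq ℓ R
  rw [hlR, finrank_bot] at hdim
  rw [← main_count hd (ℓ ⊔ R) ℓ ⟨by omega, hti⟩ le_sup_left (n - 1) (by omega)]
  apply Nat.card_congr
  apply Equiv.subtypeEquivRight
  intro μ
  refine and_congr_right fun _ => ?_
  constructor
  · rintro ⟨h1, h2⟩
    rw [inf_comm, sup_inf_assoc_of_le R h1, inf_comm R, h2, sup_bot_eq]
  · intro h
    have h1 : ℓ ≤ μ := by rw [← h]; exact inf_le_left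
    refine ⟨h1, ?_⟩
    rw [eq_bot_iff, ← hlR]
    refine le_inf ?_ inf_le_right
    rw [← h]
    exact inf_le_inf_left _ le_sup_right

lemma count_case2 (hd : QD q F) (ℓ R : Submodule F (Fin (2*n+2) → F)) (hl : Module.finrank F ℓ = 2)
    (hR : Module.finrank F R + 2 = n) (hlR : ℓ ⊓ R = ⊥) (hti : TotallyIsotropic q (ℓ ⊔ R)) :
    Nat.card {μ : Submodule F (Fin (2*n+2) → F) // IsGenerator q n μ ∧ ℓ ≤ μ ∧ μ ⊓ R = ⊥}
      = (q + 1) * (q ^ 2) ^ (n - 2) * q ^ ((n - 2) ^ 2) := by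
  classical
  have hdim := Submodule.finrank_sup_add_finrank_inf_eq ℓ R
  rw [hlR, finrank_bot, hl] at hdim
  have hdim0 : Module.finrank F (ℓ ⊔ R : Submodule F (Fin (2*n+2) → F)) = n := by omega
  obtain ⟨E0, hE0⟩ : ∃ E0, E0 = ℓ ⊔ R := ⟨_, rfl⟩
  rw [← hE0] at hti hdim0
  have hlE0 : ℓ ≤ E0 := hE0 ▸ le_sup_left
  have hRE0 : R ≤ E0 := hE0 ▸ le_sup_right
  have hpE0 := finrank_polar hd E0
  have hpl := finrank_polar hd ℓ
  have hμE0 : ∀ μ : Submodule F (Fin (2*n+2) → F), ℓ ≤ μ → μ ⊓ R = ⊥ → μ ⊓ E0 = ℓ := by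
    intro μ h1 h2
    rw [hE0, inf_comm, sup_inf_assoc_of_le R h1, inf_comm R, h2, sup_bot_eq]
  have hex : ∀ E : {E : Submodule F (Fin (2*n+2) → F) // IsGenerator q n E ∧ E0 ≤ E},
      ∃ e ∈ E.1, e ∉ E0 := fun E => exists_mem_not_mem (by rw [E.2.1.1]; omega)
  choose e heE he0 using hex
  have hEspan : ∀ E : {E : Submodule F (Fin (2*n+2) → F) // IsGenerator q n E ∧ E0 ≤ E},
      ∀ g ∈ E.1, g ∉ E0 → E0 ⊔ Submodule.span F {g} = E.1 := by
    intro E g hg hg0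
    apply Submodule.eq_of_le_of_finrank_eq
    · exact sup_le E.2.2 (by rwa [Submodule.span_singleton_le_iff_mem])
    · rw [finrank_sup_singleton hg0, E.2.1.1]; omega
  have hdecomp : ∀ E : {E : Submodule F (Fin (2*n+2) → F) // IsGenerator q n E ∧ E0 ≤ E},
      ∀ g ∈ E.1, g ∉ E0 → ∀ x ∈ E.1, ∃ l ∈ ℓ, ∃ t ∈ R, ∃ c : F, x = l + t + c • g := by
    intro E g hg hg0 x hx
    rw [← hEspan E g hg hg0] at hx
    obtain ⟨y, hy, z, hz, rfl⟩ := Submodule.mem_sup.1 hx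
    rw [hE0] at hy
    obtain ⟨l, hl, t, ht, rfl⟩ := Submodule.mem_sup.1 hy
    obtain ⟨c, rfl⟩ := Submodule.mem_span_singleton.1 hz
    exact ⟨l, hl, t, ht, c, rfl⟩
  rw [card_rel (T := {E : Submodule F (Fin (2*n+2) → F) // IsGenerator q n E ∧ E0 ≤ E} × R)
    (fun μ x => e x.1 + (x.2 : Fin (2*n+2) → F) ∈ μ.1) (q ^ ((n - 2) ^ 2)) ?_ ?_]
  · rw [Nat.card_prod, gen_count hd E0 hti hdim0]
    congr 2
    rw [Nat.card_eq_fintype_card, Module.card_eq_pow_finrank (K := F) (V := R), hd.card]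
    congr 1
    omega
  · rintro ⟨μ, hμ, hlμ, hμR⟩
    have hμ0 := hμE0 μ hlμ hμR
    have hg : ∃ g ∈ μ ⊓ polar q E0, g ∉ ℓ := by
      apply exists_mem_not_mem
      have h1 := Submodule.finrank_sup_add_finrank_inf_eq μ (polar q E0)
      have h2 : μ ⊔ polar q E0 ≤ polar q ℓ :=
        sup_le ((hμ.2.le hd).trans (polar_anti hlμ)) (polar_anti hlE0)
      have h3 := Submodule.finrank_mono h2
      rw [hμ.1] at h1
      omega
    obtain ⟨g, ⟨hgμ, hgp⟩, hgl⟩ := hg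
    have hg0 : g ∉ E0 := fun h => hgl (hμ0 ▸ ⟨hgμ, h⟩)
    have hgen : IsGenerator q n (E0 ⊔ Submodule.span F {g}) :=
      ⟨by rw [finrank_sup_singleton hg0, hdim0],
        ti_sup hd hti (ti_singleton hd (hμ.2 g hgμ)) (singleton_le_polar hd hgp)⟩
    let E : {E : Submodule F (Fin (2*n+2) → F) // IsGenerator q n E ∧ E0 ≤ E} :=
      ⟨_, hgen, le_sup_left⟩
    have hgE : g ∈ E.1 := Submodule.mem_sup_right (Submodule.mem_span_singleton_self g)
    obtain ⟨l, hl, t, ht, c, hc⟩ := hdecomp E g hgE hg0 _ (heE E)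
    have hmem : e E + -t ∈ μ := by
      have : e E + -t = l + c • g := by rw [hc]; abel
      rw [this]
      exact μ.add_mem (hlμ hl) (μ.smul_mem _ hgμ)
    refine ⟨(E, ⟨-t, R.neg_mem ht⟩), hmem, ?_⟩
    rintro ⟨E', ⟨t', ht'⟩⟩ hmem'
    change e E' + t' ∈ μ at hmem'
    have hgpE : e E' + t' ∈ E'.1 := E'.1.add_mem (heE E') (E'.2.2 (hRE0 ht'))
    have hgp0 : e E' + t' ∉ E0 := fun h => he0 E' (by
      have := E0.sub_mem h (hRE0 ht')
      simpa using this)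
    have hEE : E' = E := by
      apply Subtype.ext
      have hti2 : TotallyIsotropic q (E.1 ⊔ Submodule.span F {e E' + t'}) := by
        apply ti_sup hd hgen.2 (ti_singleton hd (hμ.2 _ hmem'))
        apply sup_le
        · exact singleton_le_polar hd (polar_anti E'.2.2 (E'.2.1.2.le hd hgpE))
        · apply span_le_polar hd
          rintro x rfl y rfl
          exact hμ.2.eq hd hgμ hmem'
      have hle := ti_finrank_le hd hti2
      have hin : e E' + t' ∈ E.1 := by
        by_contra hout
        rw [finrank_sup_singleton hout, hgen.1] at hle
        omega
      rw [← hEspan E' _ hgpE hgp0, ← hEspan E _ hin hgp0]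
    subst hEE
    have : t' - -t ∈ μ ⊓ R := by
      refine ⟨?_, R.sub_mem ht' (R.neg_mem ht)⟩
      have := μ.sub_mem hmem' hmem
      simpa using this
    rw [hμR, Submodule.mem_bot, sub_eq_zero] at this
    subst this
    rfl
  · rintro ⟨E, ⟨t, ht⟩⟩
    have hgE : e E + t ∈ E.1 := E.1.add_mem (heE E) (E.2.2 (hRE0 ht))
    have hg0 : e E + t ∉ E0 := fun h => he0 E (by
      have := E0.sub_mem h (hRE0 ht)
      simpa using this)
    have hgl : e E + t ∉ ℓ := fun h => hg0 (hlE0 h)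
    have hSE : ℓ ⊔ Submodule.span F {e E + t} ≤ E.1 :=
      sup_le (hlE0.trans E.2.2) (by rwa [Submodule.span_singleton_le_iff_mem])
    rw [← main_count hd E.1 _ E.2.1 hSE (n - 2) (by rw [finrank_sup_singleton hgl]; omega)]
    refine (Nat.card_congr (Equiv.subtypeSubtypeEquivSubtypeInter (fun μ : Submodule F (Fin (2*n+2) → F) => IsGenerator q n μ ∧ ℓ ≤ μ ∧ μ ⊓ R = ⊥) (fun μ => e E + t ∈ μ))).trans ?_
    apply Nat.card_congr
    apply Equiv.subtypeEquivRight
    intro μ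
    change ((IsGenerator q n μ ∧ ℓ ≤ μ ∧ μ ⊓ R = ⊥) ∧ e E + t ∈ μ) ↔ _
    constructor
    · rintro ⟨⟨hμ, hlμ, hμR⟩, hm⟩
      refine ⟨hμ, le_antisymm ?_ (le_inf (sup_le hlμ (by rwa [Submodule.span_singleton_le_iff_mem])) hSE)⟩
      rintro x ⟨hxμ, hxE⟩
      obtain ⟨l, hl, t', ht', c, rfl⟩ := hdecomp E _ hgE hg0 x hxE
      have : t' ∈ μ ⊓ R := by
        refine ⟨?_, ht'⟩
        have := μ.sub_mem (μ.sub_mem hxμ (μ.smul_mem c hm)) (hlμ hl)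
        simpa using this
      rw [hμR, Submodule.mem_bot] at this
      subst this
      rw [add_zero]
      exact Submodule.add_mem_sup hl (Submodule.smul_mem _ _ (Submodule.mem_span_singleton_self _))
    · rintro ⟨hμ, hμE⟩
      have hS : ℓ ⊔ Submodule.span F {e E + t} ≤ μ := by rw [← hμE]; exact inf_le_left
      refine ⟨⟨hμ, le_sup_left.trans hS, ?_⟩, hS (Submodule.mem_sup_right (Submodule.mem_span_singleton_self _))⟩
      rw [eq_bot_iff]
      rintro x ⟨hxμ, hxR⟩
      have hx : x ∈ μ ⊓ E.1 := ⟨hxμ, E.2.2 (hRE0 hxR)⟩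
      rw [hμE] at hx
      obtain ⟨l, hl, z, hz, rfl⟩ := Submodule.mem_sup.1 hx
      obtain ⟨c, rfl⟩ := Submodule.mem_span_singleton.1 hz
      have hc : c = 0 := by
        by_contra hc
        apply hg0
        have h1 := E0.sub_mem (hRE0 hxR) (hlE0 hl)
        rw [add_sub_cancel_left] at h1
        exact (E0.smul_mem_iff hc).1 h1
      subst hc
      rw [zero_smul, add_zero] at hxR ⊢
      rw [← hlR]
      exact ⟨hl, hxR⟩

end count2

section points
variable {q : ℕ} {F : Type} [Field F] [Fintype F] {n : ℕ}

lemma exists_span_of_finrank_one {m : ℕ} {A : Submodule F (Fin m → F)}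
    (h : Module.finrank F A = 1) : ∃ a, a ≠ 0 ∧ A = Submodule.span F {a} := by
  obtain ⟨v, hv, hs⟩ := finrank_eq_one_iff'.1 h
  refine ⟨v, fun h0 => hv (Subtype.ext h0), le_antisymm ?_ ?_⟩
  · intro x hx
    obtain ⟨c, hc⟩ := hs ⟨x, hx⟩
    exact Submodule.mem_span_singleton.2 ⟨c, congrArg Subtype.val hc⟩
  · rw [Submodule.span_singleton_le_iff_mem]; exact v.2

lemma iso_line (hd : QD q F) {A B R : Submodule F (Fin (2*n+2) → F)} (hAB : A ≤ polar q B)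
    (hB : Module.finrank F B = n + 1) (hR : R = A ⊓ B) (hrn : n ≤ Module.finrank F R + 2)
    {a x : Fin (2*n+2) → F} (ha : a ∈ A) (haa : herm q a a = 0) (haR : a ∉ R)
    (hx : x ∈ A) (hxx : herm q x x = 0) (hxa : herm q x a = 0) :
    x ∈ R ⊔ Submodule.span F {a} := by
  by_contra hnot
  have hRA : R ≤ A := hR ▸ inf_le_left
  have hRB : R ≤ B := hR ▸ inf_le_right
  have hBA : B ≤ polar q A := le_polar_symm hd hAB
  have hRti : TotallyIsotropic q R := ti_of_le ((hRA.trans hAB).trans (polar_anti hRB))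
  have hWA : R ⊔ Submodule.span F {a} ⊔ Submodule.span F {x} ≤ A :=
    sup_le (sup_le hRA (by rwa [Submodule.span_singleton_le_iff_mem]))
      (by rwa [Submodule.span_singleton_le_iff_mem])
  have hti : TotallyIsotropic q (R ⊔ Submodule.span F {a} ⊔ Submodule.span F {x}) := by
    refine ti_sup hd (ti_sup hd hRti (ti_singleton hd haa) (singleton_le_polar hd ?_))
      (ti_singleton hd hxx) (sup_le (singleton_le_polar hd ?_) ?_)
    · exact polar_anti hRB (hAB ha)
    · exact polar_anti hRB (hAB hx)
    · apply span_le_polar hd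
      rintro y rfl z rfl
      exact herm_comm_zero hd hxa
  have h1 := finrank_polar hd (R ⊔ Submodule.span F {a} ⊔ Submodule.span F {x})
  have h2 := Submodule.finrank_mono (sup_le (hti.le hd) (hBA.trans (polar_anti hWA)))
  have h3 := Submodule.finrank_sup_add_finrank_inf_eq
    (R ⊔ Submodule.span F {a} ⊔ Submodule.span F {x}) B
  have h4 : (R ⊔ Submodule.span F {a} ⊔ Submodule.span F {x}) ⊓ B = R := by
    apply le_antisymm
    · conv_rhs => rw [hR]
      exact inf_le_inf_right _ hWA
    · exact le_inf (le_sup_left.trans le_sup_left) hRB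
  rw [h4] at h3
  rw [finrank_sup_singleton hnot, finrank_sup_singleton haR] at h1 h3
  omega

lemma pt_fwd (hd : QD q F) {A B R μ : Submodule F (Fin (2*n+2) → F)} (hAB : A ≤ polar q B)
    (hB : Module.finrank F B = n + 1) (hR : R = A ⊓ B) (hrn : n ≤ Module.finrank F R + 2)
    {a b : Fin (2*n+2) → F} (ha : a ∈ A) (haa : herm q a a = 0) (haR : a ∉ R)
    (hb : b ∈ B) (hμ : TotallyIsotropic q μ) (hpμ : a + b ∈ μ)
    (h : ∃! R' : Submodule F (Fin (2*n+2) → F),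
          Module.finrank F R' = 1 ∧ R' ≤ μ ⊓ A ∧ ¬ R' ≤ R) :
    μ ⊓ R = ⊥ ∧ ∃ t ∈ R, a + t ∈ μ := by
  have hRA : R ≤ A := hR ▸ inf_le_left
  obtain ⟨R', ⟨h1, h2, h3⟩, hu⟩ := h
  obtain ⟨x, hx0, rfl⟩ := exists_span_of_finrank_one h1
  rw [Submodule.span_singleton_le_iff_mem] at h2 h3
  obtain ⟨hxμ, hxA⟩ := h2
  constructor
  · rw [eq_bot_iff]
    rintro y ⟨hyμ, hyR⟩
    have hxy : x + y ∉ R := fun h => h3 (by simpa using R.sub_mem h hyR)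
    have := hu (Submodule.span F {x + y}) ⟨finrank_span_singleton fun h0 => hxy (h0 ▸ R.zero_mem),
      by rw [Submodule.span_singleton_le_iff_mem]; exact ⟨μ.add_mem hxμ hyμ, A.add_mem hxA (hRA hyR)⟩,
      by rwa [Submodule.span_singleton_le_iff_mem]⟩
    have hmem : x + y ∈ Submodule.span F {x} := this ▸ Submodule.mem_span_singleton_self _
    have hy : y ∈ Submodule.span F {x} := by
      simpa using Submodule.sub_mem _ hmem (Submodule.mem_span_singleton_self x)
    obtain ⟨c, rfl⟩ := Submodule.mem_span_singleton.1 hy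
    by_cases hc : c = 0
    · simp [hc]
    · exact absurd ((R.smul_mem_iff hc).1 hyR) h3
  · have hxa : herm q x a = 0 := by
      have e1 := hμ.eq hd hxμ hpμ
      rw [herm_add_right hd, mem_polar.1 (hAB hxA) b hb, add_zero] at e1
      exact e1
    have := iso_line hd hAB hB hR hrn ha haa haR hxA (hμ x hxμ) hxa
    obtain ⟨t, ht, z, hz, htz⟩ := Submodule.mem_sup.1 this
    obtain ⟨c, rfl⟩ := Submodule.mem_span_singleton.1 hz
    have hc : c ≠ 0 := by
      rintro rfl
      apply h3
      rw [← htz]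
      simpa using ht
    refine ⟨c⁻¹ • t, R.smul_mem _ ht, ?_⟩
    have e2 : a + c⁻¹ • t = c⁻¹ • x := by
      rw [← htz, smul_add, smul_smul, inv_mul_cancel₀ hc, one_smul]
      exact add_comm _ _
    rw [e2]
    exact μ.smul_mem _ hxμ

lemma pt_bwd (hd : QD q F) {A B R μ : Submodule F (Fin (2*n+2) → F)} (hAB : A ≤ polar q B)
    (hB : Module.finrank F B = n + 1) (hR : R = A ⊓ B) (hrn : n ≤ Module.finrank F R + 2)
    {a t : Fin (2*n+2) → F} (ha : a ∈ A) (haa : herm q a a = 0) (haR : a ∉ R)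
    (hμ : TotallyIsotropic q μ) (hμR : μ ⊓ R = ⊥) (ht : t ∈ R) (hat : a + t ∈ μ) :
    ∃! R' : Submodule F (Fin (2*n+2) → F),
          Module.finrank F R' = 1 ∧ R' ≤ μ ⊓ A ∧ ¬ R' ≤ R := by
  have hRA : R ≤ A := hR ▸ inf_le_left
  have hatA : a + t ∈ A := A.add_mem ha (hRA ht)
  have hatR : a + t ∉ R := fun h => haR (by simpa using R.sub_mem h ht)
  have hat0 : a + t ≠ 0 := fun h0 => hatR (h0 ▸ R.zero_mem)
  refine ⟨Submodule.span F {a + t}, ⟨finrank_span_singleton hat0, ?_, ?_⟩, ?_⟩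
  · rw [Submodule.span_singleton_le_iff_mem]; exact ⟨hat, hatA⟩
  · rwa [Submodule.span_singleton_le_iff_mem]
  · rintro R' ⟨h1, h2, h3⟩
    apply Submodule.eq_of_le_of_finrank_eq
    · intro x hx
      obtain ⟨hxμ, hxA⟩ := h2 hx
      have := iso_line hd hAB hB hR hrn hatA (hμ _ hat) hatR hxA (hμ x hxμ) (hμ.eq hd hxμ hat)
      obtain ⟨s, hs, z, hz, rfl⟩ := Submodule.mem_sup.1 this
      obtain ⟨c, rfl⟩ := Submodule.mem_span_singleton.1 hz
      have hs0 : s ∈ μ ⊓ R := by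
        refine ⟨?_, hs⟩
        simpa using μ.sub_mem hxμ (μ.smul_mem c hat)
      rw [hμR, Submodule.mem_bot] at hs0
      rw [hs0, zero_add]
      exact hz
    · rw [h1, finrank_span_singleton hat0]

end points

/-- Number of generators through a point `P ∈ ⟨π, π^σ⟩` lying on a line of `H`
meeting `π \\ πᵢ` and `π^σ \\ πᵢ`, meeting each of `π \\ πᵢ` and `π^σ \\ πᵢ`
in exactly one point, for `i = n-3` or `i = n-2`. -/
theorem stmt12 (n q p hh : ℕ) (hn : 2 ≤ n) (hp : p.Prime) (hh1 : 1 ≤ hh)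
    (hq : q = p ^ hh)
    (F : Type) [Field F] [Fintype F] (hF : Fintype.card F = q ^ 2)
    (i : ℤ) (hi1 : -1 ≤ i) (hi2 : i = (n:ℤ) - 3 ∨ i = (n:ℤ) - 2)
    (π : Submodule F (Fin (2*n+2) → F)) (hπ : Module.finrank F π = n + 1)
    (hdim : (Module.finrank F ↥(π ⊓ polar q π) : ℤ) = i + 1)
    (P : Submodule F (Fin (2*n+2) → F)) (hP : IsHermPoint q P)
    (hPπ : ¬ P ≤ π) (hPσ : ¬ P ≤ polar q π)
    (hPspan : P ≤ π ⊔ polar q π)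
    (hline : OnGoodLine q π P) :
    (Nat.card {μ : Submodule F (Fin (2*n+2) → F) //
        IsGenerator q n μ ∧ P ≤ μ ∧
        (∃! R : Submodule F (Fin (2*n+2) → F),
          Module.finrank F R = 1 ∧ R ≤ μ ⊓ π ∧ ¬ R ≤ π ⊓ polar q π) ∧
        (∃! R : Submodule F (Fin (2*n+2) → F),
          Module.finrank F R = 1 ∧ R ≤ μ ⊓ polar q π ∧ ¬ R ≤ π ⊓ polar q π)} : ℚ)
      = (q:ℚ)^(2*i+2) * NN q n i := by
  classical
  haveI : Fact p.Prime := ⟨hp⟩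
  have hd : QD q F := by
    refine ⟨?_, ?_, hF⟩
    · rw [hq]
      calc 2 ≤ p := hp.two_le
        _ = p ^ 1 := (pow_one p).symm
        _ ≤ p ^ hh := Nat.pow_le_pow_right hp.pos hh1
    · haveI : CharP F p := charP_of_card_eq_prime_pow (f := hh * 2) (by rw [hF, hq, pow_mul])
      intro x y
      rw [hq]
      exact add_pow_char_pow x y p hh
  obtain ⟨A, B, hA1, hAπ, hAR, hB1, hBπ, hBR, hPAB, hABti⟩ := hline
  obtain ⟨p0, hp00, rfl⟩ := exists_span_of_finrank_one hP.1
  obtain ⟨a0, ha00, rfl⟩ := exists_span_of_finrank_one hA1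
  obtain ⟨b0, hb00, rfl⟩ := exists_span_of_finrank_one hB1
  rw [Submodule.span_singleton_le_iff_mem] at hPπ hPσ hPAB hAπ hAR hBπ hBR
  obtain ⟨y, hy, z, hz, hyz⟩ := Submodule.mem_sup.1 hPAB
  obtain ⟨α, rfl⟩ := Submodule.mem_span_singleton.1 hy
  obtain ⟨β, rfl⟩ := Submodule.mem_span_singleton.1 hz
  have hα : α ≠ 0 := by
    rintro rfl
    apply hPσ
    rw [← hyz, zero_smul, zero_add]
    exact Submodule.smul_mem _ _ hBπ
  have hβ : β ≠ 0 := by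
    rintro rfl
    apply hPπ
    rw [← hyz, zero_smul, add_zero]
    exact Submodule.smul_mem _ _ hAπ
  obtain ⟨a, ha⟩ : ∃ a, a = α • a0 := ⟨_, rfl⟩
  obtain ⟨b, hb⟩ : ∃ b, b = β • b0 := ⟨_, rfl⟩
  obtain ⟨R, hR⟩ : ∃ R, R = π ⊓ polar q π := ⟨_, rfl⟩
  have haa : herm q a a = 0 := hABti a (Submodule.mem_sup_left (ha ▸ hy))
  have hbb : herm q b b = 0 := hABti b (Submodule.mem_sup_right (hb ▸ hz))
  have haπ : a ∈ π := ha ▸ π.smul_mem _ hAπ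
  have hbπ : b ∈ polar q π := hb ▸ Submodule.smul_mem _ _ hBπ
  have haR : a ∉ R := by
    rw [ha, hR, Submodule.smul_mem_iff _ hα]; exact hAR
  have hbR : b ∉ R := by
    rw [hb, hR, Submodule.smul_mem_iff _ hβ]; exact hBR
  rw [← ha, ← hb] at hyz
  subst hyz
  rw [← hR] at hdim ⊢
  have hR' : R = polar q π ⊓ π := by rw [hR, inf_comm]
  have hpπ : Module.finrank F (polar q π) = n + 1 := by
    have := finrank_polar hd π
    omega
  have hπp : π ≤ polar q (polar q π) := le_polar_symm hd le_rfl
  have hrn : n ≤ Module.finrank F R + 2 := by omega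
  have hRπ : R ≤ π := hR ▸ inf_le_left
  have hRp : R ≤ polar q π := hR ▸ inf_le_right
  have hRti : TotallyIsotropic q R := ti_of_le (hRp.trans (polar_anti hRπ))
  have hab : ∀ x ∈ π, ∀ y ∈ polar q π, herm q x y = 0 := fun x hx y hy =>
    herm_comm_zero hd (mem_polar.1 hy x hx)
  have hcong : Nat.card {μ : Submodule F (Fin (2*n+2) → F) //
        IsGenerator q n μ ∧ Submodule.span F {a + b} ≤ μ ∧
        (∃! R' : Submodule F (Fin (2*n+2) → F),
          Module.finrank F R' = 1 ∧ R' ≤ μ ⊓ π ∧ ¬ R' ≤ R) ∧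
        (∃! R' : Submodule F (Fin (2*n+2) → F),
          Module.finrank F R' = 1 ∧ R' ≤ μ ⊓ polar q π ∧ ¬ R' ≤ R)} =
      Nat.card {μ : Submodule F (Fin (2*n+2) → F) //
        IsGenerator q n μ ∧ a + b ∈ μ ∧ μ ⊓ R = ⊥ ∧ ∃ t ∈ R, a + t ∈ μ} := by
    apply Nat.card_congr
    apply Equiv.subtypeEquivRight
    intro μ
    rw [Submodule.span_singleton_le_iff_mem]
    refine and_congr_right fun hμ => and_congr_right fun hpμ => ?_
    constructor
    · rintro ⟨h1, _⟩
      exact pt_fwd hd hπp hpπ hR hrn haπ haa haR hbπ hμ.2 hpμ h1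
    · rintro ⟨h1, t, ht, hat⟩
      refine ⟨pt_bwd hd hπp hpπ hR hrn haπ haa haR hμ.2 h1 ht hat, ?_⟩
      refine pt_bwd hd le_rfl hπ hR' hrn hbπ hbb hbR hμ.2 h1 (R.neg_mem ht) ?_
      have := μ.sub_mem hpμ hat
      convert this using 1
      abel
  rw [hcong]
  have hfib : ∀ t : R, ∃ ℓ : Submodule F (Fin (2*n+2) → F), Module.finrank F ℓ = 2 ∧ ℓ ⊓ R = ⊥ ∧
      TotallyIsotropic q (ℓ ⊔ R) ∧ ∀ μ : Submodule F (Fin (2*n+2) → F), ℓ ≤ μ ↔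
        (a + b ∈ μ ∧ a + (t : Fin (2*n+2) → F) ∈ μ) := by
    rintro ⟨t, ht⟩
    have h1 : a + t ∈ π := π.add_mem haπ (hRπ ht)
    have h2 : b - t ∈ polar q π := Submodule.sub_mem _ hbπ (hRp ht)
    have h1R : a + t ∉ R := fun h => haR (by simpa using R.sub_mem h ht)
    have h2R : b - t ∉ R := fun h => hbR (by simpa using R.add_mem h ht)
    have hnot : b - t ∉ R ⊔ Submodule.span F {a + t} := by
      intro h
      have : b - t ∈ π := (sup_le hRπ (by rwa [Submodule.span_singleton_le_iff_mem])) h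
      exact h2R (by rw [hR]; exact ⟨this, h2⟩)
    have hsup : (Submodule.span F {a + t} ⊔ Submodule.span F {b - t}) ⊔ R =
        (R ⊔ Submodule.span F {a + t}) ⊔ Submodule.span F {b - t} := by
      rw [sup_comm, sup_assoc]
    have hd2 : Module.finrank F (Submodule.span F {a + t} ⊔ Submodule.span F {b - t} :
        Submodule F (Fin (2*n+2) → F)) = 2 := by
      rw [finrank_sup_singleton (fun h => hnot (Submodule.mem_sup_right h)), finrank_span_singleton]
      intro h0
      exact h1R (h0 ▸ R.zero_mem)
    refine ⟨Submodule.span F {a + t} ⊔ Submodule.span F {b - t}, hd2, ?_, ?_, ?_⟩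
    · have h3 := Submodule.finrank_sup_add_finrank_inf_eq
        (Submodule.span F {a + t} ⊔ Submodule.span F {b - t}) R
      rw [hsup, finrank_sup_singleton hnot, finrank_sup_singleton h1R, hd2] at h3
      exact Submodule.finrank_eq_zero.1 (by omega)
    · rw [hsup]
      have hta : herm q t a = 0 := mem_polar.1 (hRp ht) a haπ
      have htb : herm q t b = 0 := hab t (hRπ ht) b hbπ
      have htt : herm q t t = 0 := hRti t ht
      refine ti_sup hd (ti_sup hd hRti (ti_singleton hd ?_) (singleton_le_polar hd ?_))
        (ti_singleton hd ?_) (singleton_le_polar hd ?_)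
      · rw [herm_add_left, herm_add_right hd, herm_add_right hd, haa, htt, hta,
          herm_comm_zero hd hta]; simp
      · exact polar_anti hRp (hπp h1)
      · rw [sub_eq_add_neg, herm_add_left, herm_add_right hd, herm_add_right hd, hbb,
          herm_neg_left, herm_neg_left, htb, ← neg_one_smul F t, herm_smul_right hd,
          herm_smul_right hd, htt, herm_comm_zero hd htb]; simp
      · exact polar_anti (sup_le hRπ (by rwa [Submodule.span_singleton_le_iff_mem])) h2
    · intro μ
      rw [sup_le_iff, Submodule.span_singleton_le_iff_mem, Submodule.span_singleton_le_iff_mem]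
      constructor
      · rintro ⟨h3, h4⟩
        refine ⟨?_, h3⟩
        have := μ.add_mem h3 h4
        convert this using 1
        abel
      · rintro ⟨h3, h4⟩
        refine ⟨h4, ?_⟩
        have := μ.sub_mem h3 h4
        convert this using 1
        abel
  have hcount : ∀ c : ℕ, (∀ ℓ : Submodule F (Fin (2*n+2) → F), Module.finrank F ℓ = 2 → ℓ ⊓ R = ⊥ →
      TotallyIsotropic q (ℓ ⊔ R) → Nat.card {μ : Submodule F (Fin (2*n+2) → F) //
        IsGenerator q n μ ∧ ℓ ≤ μ ∧ μ ⊓ R = ⊥} = c) →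
      Nat.card {μ : Submodule F (Fin (2*n+2) → F) //
        IsGenerator q n μ ∧ a + b ∈ μ ∧ μ ⊓ R = ⊥ ∧ ∃ t ∈ R, a + t ∈ μ} =
      (q ^ 2) ^ Module.finrank F R * c := by
    intro c hc
    rw [card_rel (T := R) (fun μ t => a + (t : Fin (2*n+2) → F) ∈ μ.1) c ?_ ?_]
    · rw [Nat.card_eq_fintype_card, Module.card_eq_pow_finrank (K := F) (V := R), hd.card]
    · rintro ⟨μ, hμ, hpμ, hμR, t, ht, hat⟩
      refine ⟨⟨t, ht⟩, hat, ?_⟩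
      rintro ⟨t', ht'⟩ hat'
      apply Subtype.ext
      have : t' - t ∈ μ ⊓ R := by
        refine ⟨?_, R.sub_mem ht' ht⟩
        have := μ.sub_mem hat' hat
        simpa using this
      rw [hμR, Submodule.mem_bot, sub_eq_zero] at this
      exact this
    · intro t
      obtain ⟨ℓ, hl1, hl2, hl3, hl4⟩ := hfib t
      rw [← hc ℓ hl1 hl2 hl3]
      refine (Nat.card_congr (Equiv.subtypeSubtypeEquivSubtypeInter
        (fun μ : Submodule F (Fin (2*n+2) → F) => IsGenerator q n μ ∧ a + b ∈ μ ∧ μ ⊓ R = ⊥ ∧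
          ∃ t ∈ R, a + t ∈ μ) (fun μ => a + (t : Fin (2*n+2) → F) ∈ μ))).trans ?_
      apply Nat.card_congr
      apply Equiv.subtypeEquivRight
      intro μ
      rw [hl4]
      constructor
      · rintro ⟨⟨h1, h2, h3, _⟩, h5⟩
        exact ⟨h1, ⟨h2, h5⟩, h3⟩
      · rintro ⟨h1, ⟨h2, h5⟩, h3⟩
        exact ⟨⟨h1, h2, h3, t, t.2, h5⟩, h5⟩
  have hqpos : (q : ℚ) ≠ 0 := by
    have := hd.two
    positivity
  have hexp : (q:ℚ)^(2*i+2) = ((q ^ 2 : ℕ) : ℚ) ^ Module.finrank F R := by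
    rw [show 2*i+2 = ((2 * Module.finrank F R : ℕ) : ℤ) by push_cast; omega, zpow_natCast, pow_mul]
    push_cast
    rfl
  rcases hi2 with hi | hi
  · have hr : Module.finrank F R + 2 = n := by omega
    rw [hcount _ (fun ℓ h1 h2 h3 => count_case2 hd ℓ R h1 hr h2 h3), hexp]
    push_cast
    congr 1
    obtain ⟨k, rfl⟩ : ∃ k, n = k + 2 := ⟨n - 2, by omega⟩
    have e1 : (((k + 2 : ℕ):ℤ) - i - 1).toNat = 2 := by omega
    have e2 : (((k + 2 : ℕ):ℤ) - i - 2).toNat = 1 := by omega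
    rw [NN, e1, e2]
    have e3 : (((k + 2 : ℕ):ℤ) - 1) ^ 2 - ((Nat.choose 2 2 : ℕ) : ℤ) = ((k ^ 2 + 2 * k : ℕ) : ℤ) := by
      push_cast [Nat.choose_self]; ring
    rw [e3, zpow_natCast]
    simp
    ring
  · have hr : Module.finrank F R + 1 = n := by omega
    rw [hcount _ (fun ℓ h1 h2 h3 => count_case1 hd ℓ R h1 hr h2 h3), hexp]
    push_cast
    congr 1
    obtain ⟨k, rfl⟩ : ∃ k, n = k + 1 := ⟨n - 1, by omega⟩
    have e1 : (((k + 1 : ℕ):ℤ) - i - 1).toNat = 1 := by omega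
    have e2 : (((k + 1 : ℕ):ℤ) - i - 2).toNat = 0 := by omega
    rw [NN, e1, e2]
    have e3 : (((k + 1 : ℕ):ℤ) - 1) ^ 2 - ((Nat.choose 1 2 : ℕ) : ℤ) = ((k ^ 2 : ℕ) : ℤ) := by
      simp
    rw [e3, zpow_natCast]
    simp



end HermCode
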